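/- Let m ≥ 2 be an integer. For every positive integer n and every m-homogeneous polynomial P(x) = ∑_{|α|=m} a_α x^α on real ℓ_m^n, one has max_{|α|=m} |a_α| ≤ (√2)^{m−1} m^m ‖P‖. -/

import Mathlib

open scoped BigOperators

/-- The `ℓ_p` norm of a vector in `ℝ^n`: `(∑ i, |x i|^p)^(1/p)`. -/
noncomputable def lpNorm (p : ℝ) {n : ℕ} (x : Fin n → ℝ) : ℝ :=
  (∑ i, ‖x i‖ ^ p) ^ (1 / p)

/-- The sup norm of a real polynomial on the unit ball of `ℓ_p^n`. -/
noncomputable def polyNorm (p : ℝ) {n : ℕ} (P : MvPolynomial (Fin n) ℝ) : ℝ :=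
  sSup {t : ℝ | ∃ x : Fin n → ℝ, lpNorm p x ≤ 1 ∧ t = ‖MvPolynomial.eval x P‖}

/-- The coefficient of the `j`-th sample in a finite difference of order `a`. -/
def diffWeight (a j : ℕ) : ℝ := (-1) ^ (a - j) * (a.choose j : ℝ)

theorem sum_diffWeight_mul_pow (a b : ℕ) :
    ∑ j ∈ Finset.range (a + 1), diffWeight a j * ((j : ℝ) - a / 2) ^ b =
      ((fwdDiff (1 : ℝ))^[a] (fun r : ℝ ↦ r ^ b)) (-(a / 2)) := by
  rw [fwdDiff_iter_eq_sum_shift]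
  refine Finset.sum_congr rfl fun j _ ↦ ?_
  simp only [diffWeight, zsmul_eq_mul, nsmul_eq_mul, mul_one]
  push_cast
  ring

theorem sum_diffWeight_mul_pow_of_lt {a b : ℕ} (h : b < a) :
    ∑ j ∈ Finset.range (a + 1), diffWeight a j * ((j : ℝ) - a / 2) ^ b = 0 := by
  rw [sum_diffWeight_mul_pow, fwdDiff_iter_pow_eq_zero_of_lt h, Pi.zero_apply]

theorem sum_diffWeight_mul_pow_self (a : ℕ) :
    ∑ j ∈ Finset.range (a + 1), diffWeight a j * ((j : ℝ) - a / 2) ^ a = a.factorial := by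
  rw [sum_diffWeight_mul_pow, fwdDiff_iter_eq_factorial, Pi.natCast_apply]

theorem sum_abs_diffWeight (a : ℕ) :
    ∑ j ∈ Finset.range (a + 1), |diffWeight a j| = 2 ^ a := by
  simp only [diffWeight, abs_mul, abs_pow, abs_neg, abs_one, one_pow, one_mul, Nat.abs_cast]
  exact_mod_cast Nat.sum_range_choose a

theorem abs_apply_le_one_of_lpNorm_le_one {m n : ℕ} (hm : m ≠ 0) {x : Fin n → ℝ}
    (hx : lpNorm (m : ℝ) x ≤ 1) (i : Fin n) : |x i| ≤ 1 := by
  have h0 : 0 ≤ ∑ i, ‖x i‖ ^ (m : ℝ) := Finset.sum_nonneg fun _ _ ↦ by positivity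
  have hs : ∑ i, ‖x i‖ ^ (m : ℝ) ≤ 1 := by
    by_contra! h
    exact absurd hx (not_le.mpr (Real.one_lt_rpow h (by positivity)))
  have hi : ‖x i‖ ^ (m : ℝ) ≤ 1 :=
    (Finset.single_le_sum (f := fun i ↦ ‖x i‖ ^ (m : ℝ)) (fun _ _ ↦ by positivity)
      (Finset.mem_univ i)).trans hs
  rw [Real.rpow_natCast] at hi
  exact (pow_le_one_iff_of_nonneg (norm_nonneg _) hm).mp hi

theorem abs_eval_le_polyNorm {m n : ℕ} (hm : m ≠ 0) (P : MvPolynomial (Fin n) ℝ)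
    {x : Fin n → ℝ} (hx : lpNorm (m : ℝ) x ≤ 1) :
    |MvPolynomial.eval x P| ≤ polyNorm (m : ℝ) P := by
  refine le_csSup ⟨∑ d ∈ P.support, |P.coeff d|, ?_⟩ ⟨x, hx, rfl⟩
  rintro _ ⟨y, hy, rfl⟩
  rw [MvPolynomial.eval_eq', Real.norm_eq_abs]
  refine (Finset.abs_sum_le_sum_abs _ _).trans (Finset.sum_le_sum fun d _ ↦ ?_)
  rw [abs_mul, Finset.abs_prod]
  refine mul_le_of_le_one_right (abs_nonneg _) (Finset.prod_le_one (fun _ _ ↦ abs_nonneg _) ?_)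
  intro i _
  rw [abs_pow]
  exact pow_le_one₀ (abs_nonneg _) (abs_apply_le_one_of_lpNorm_le_one hm hy i)

theorem lpNorm_le_one_of_sum_abs_le_one {m n : ℕ} (hm : m ≠ 0) {x : Fin n → ℝ}
    (hx : ∑ i, |x i| ≤ 1) : lpNorm (m : ℝ) x ≤ 1 := by
  refine Real.rpow_le_one (Finset.sum_nonneg fun _ _ ↦ by positivity) ?_ (by positivity)
  refine (Finset.sum_le_sum fun i _ ↦ ?_).trans hx
  rw [Real.rpow_natCast, Real.norm_eq_abs]
  refine pow_le_of_le_one (abs_nonneg _) ?_ hm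
  exact (Finset.single_le_sum (f := fun i ↦ |x i|) (fun _ _ ↦ abs_nonneg _)
    (Finset.mem_univ i)).trans hx

theorem MvPolynomial.IsHomogeneous.sum_eq_of_mem_support {m n : ℕ} {P : MvPolynomial (Fin n) ℝ}
    (hP : P.IsHomogeneous m) {d : Fin n →₀ ℕ} (hd : d ∈ P.support) : ∑ i, d i = m := by
  rw [← Finsupp.degree_eq_sum, Finsupp.degree_eq_weight_one]
  exact hP (MvPolynomial.mem_support_iff.mp hd)

theorem MvPolynomial.IsHomogeneous.eval_const_mul {m n : ℕ} {P : MvPolynomial (Fin n) ℝ}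
    (hP : P.IsHomogeneous m) (c : ℝ) (x : Fin n → ℝ) :
    MvPolynomial.eval (fun i ↦ c * x i) P = c ^ m * MvPolynomial.eval x P := by
  simp only [MvPolynomial.eval_eq', Finset.mul_sum]
  refine Finset.sum_congr rfl fun d hd ↦ ?_
  have hdeg := hP.sum_eq_of_mem_support hd
  simp only [mul_pow, Finset.prod_mul_distrib, Finset.prod_pow_eq_pow_sum, hdeg]
  ring

theorem abs_eval_le_of_sum_abs_le {m n : ℕ} (hm : m ≠ 0) {P : MvPolynomial (Fin n) ℝ}
    (hP : P.IsHomogeneous m) {r : ℝ} (hr : 0 < r) {x : Fin n → ℝ} (hx : ∑ i, |x i| ≤ r) :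
    |MvPolynomial.eval x P| ≤ r ^ m * polyNorm (m : ℝ) P := by
  have hy : lpNorm (m : ℝ) (fun i ↦ r⁻¹ * x i) ≤ 1 := by
    refine lpNorm_le_one_of_sum_abs_le_one hm ?_
    simp only [abs_mul, ← Finset.mul_sum, abs_inv, abs_of_pos hr]
    exact inv_mul_le_one_of_le₀ hx hr.le
  have h := abs_eval_le_polyNorm hm P hy
  rwa [hP.eval_const_mul, abs_mul, abs_pow, abs_inv, abs_of_pos hr, inv_pow,
    inv_mul_le_iff₀ (by positivity)] at h

/-- The iterated central difference of order `α` of a homogeneous polynomial of degree `|α|` is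
`α!` times its coefficient at `α`. -/
theorem sum_diffWeight_mul_eval {m n : ℕ} {P : MvPolynomial (Fin n) ℝ} (hP : P.IsHomogeneous m)
    {α : Fin n →₀ ℕ} (hα : ∑ i, α i = m) :
    ∑ k ∈ Fintype.piFinset (fun i ↦ Finset.range (α i + 1)),
      (∏ i, diffWeight (α i) (k i)) * MvPolynomial.eval (fun i ↦ (k i : ℝ) - α i / 2) P =
      (∏ i, ((α i).factorial : ℝ)) * P.coeff α := by
  have hsum : ∀ d : Fin n →₀ ℕ, ∑ k ∈ Fintype.piFinset (fun i ↦ Finset.range (α i + 1)),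
      (∏ i, diffWeight (α i) (k i)) * (P.coeff d * ∏ i, ((k i : ℝ) - α i / 2) ^ d i) =
      P.coeff d * ∏ i, ∑ j ∈ Finset.range (α i + 1),
        diffWeight (α i) j * ((j : ℝ) - α i / 2) ^ d i := by
    intro d
    rw [Finset.prod_univ_sum, Finset.mul_sum]
    refine Finset.sum_congr rfl fun k _ ↦ ?_
    rw [Finset.prod_mul_distrib]
    ring
  simp only [MvPolynomial.eval_eq', Finset.mul_sum]
  rw [Finset.sum_comm, Finset.sum_congr rfl fun d _ ↦ hsum d, Finset.sum_eq_single α]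
  · simp only [sum_diffWeight_mul_pow_self]
    ring
  · intro d hd hne
    have hdeg := hP.sum_eq_of_mem_support hd
    obtain ⟨i, hi⟩ : ∃ i, d i < α i := by
      by_contra! h
      refine hne (Finsupp.ext fun i ↦ ?_)
      exact (((Finset.sum_eq_sum_iff_of_le fun i _ ↦ h i).mp (hα.trans hdeg.symm)) i
        (Finset.mem_univ i)).symm
    rw [Finset.prod_eq_zero (Finset.mem_univ i) (sum_diffWeight_mul_pow_of_lt hi), mul_zero]
  · intro h
    rw [MvPolynomial.notMem_support_iff.mp h, zero_mul]

theorem abs_coeff_le_pow_mul_polyNorm {m n : ℕ} (hm : m ≠ 0) {P : MvPolynomial (Fin n) ℝ}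
    (hP : P.IsHomogeneous m) {α : Fin n →₀ ℕ} (hα : ∑ i, α i = m) :
    |P.coeff α| ≤ (m : ℝ) ^ m * polyNorm (m : ℝ) P := by
  have hfac : (1 : ℝ) ≤ ∏ i, ((α i).factorial : ℝ) := by
    exact_mod_cast Finset.prod_pos fun i _ ↦ (α i).factorial_pos
  have hpoint : ∀ k ∈ Fintype.piFinset (fun i ↦ Finset.range (α i + 1)),
      |MvPolynomial.eval (fun i ↦ (k i : ℝ) - α i / 2) P| ≤
        ((m : ℝ) / 2) ^ m * polyNorm (m : ℝ) P := by
    intro k hk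
    refine abs_eval_le_of_sum_abs_le hm hP (by positivity) ?_
    rw [← hα, Nat.cast_sum, Finset.sum_div]
    refine Finset.sum_le_sum fun i _ ↦ ?_
    have hki : (k i : ℝ) ≤ α i := by
      exact_mod_cast Nat.lt_succ_iff.mp (Finset.mem_range.mp (Fintype.mem_piFinset.mp hk i))
    have hk0 : (0 : ℝ) ≤ k i := Nat.cast_nonneg _
    rw [abs_le]
    constructor <;> linarith
  have hweight : ∑ k ∈ Fintype.piFinset (fun i ↦ Finset.range (α i + 1)),
      ∏ i, |diffWeight (α i) (k i)| = (2 : ℝ) ^ m := by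
    rw [← Finset.prod_univ_sum (fun i ↦ Finset.range (α i + 1)) fun i j ↦ |diffWeight (α i) j|]
    simp only [sum_abs_diffWeight, Finset.prod_pow_eq_pow_sum, hα]
  calc |P.coeff α| ≤ (∏ i, ((α i).factorial : ℝ)) * |P.coeff α| :=
        le_mul_of_one_le_left (abs_nonneg _) hfac
    _ = |(∏ i, ((α i).factorial : ℝ)) * P.coeff α| := by
        rw [abs_mul, abs_of_pos (one_pos.trans_le hfac)]
    _ ≤ ∑ k ∈ Fintype.piFinset (fun i ↦ Finset.range (α i + 1)),
          (∏ i, |diffWeight (α i) (k i)|) * (((m : ℝ) / 2) ^ m * polyNorm (m : ℝ) P) := by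
        rw [← sum_diffWeight_mul_eval hP hα]
        refine (Finset.abs_sum_le_sum_abs _ _).trans (Finset.sum_le_sum fun k hk ↦ ?_)
        rw [abs_mul, Finset.abs_prod]
        exact mul_le_mul_of_nonneg_left (hpoint k hk)
          (Finset.prod_nonneg fun _ _ ↦ abs_nonneg _)
    _ = (m : ℝ) ^ m * polyNorm (m : ℝ) P := by
        rw [← Finset.sum_mul, hweight, ← mul_assoc, ← mul_pow, mul_div_cancel₀ _ two_ne_zero]

theorem real_HL_m_homogeneous_on_ell_m
    (m : ℕ) (hm : 2 ≤ m) (n : ℕ) (hn : 0 < n)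
    (P : MvPolynomial (Fin n) ℝ) (hP : P.IsHomogeneous m)
    (α : Fin n →₀ ℕ) (hα : (∑ i ∈ α.support, α i) = m) :
    ‖MvPolynomial.coeff α P‖ ≤ Real.sqrt 2 ^ (m - 1) * (m : ℝ) ^ m * polyNorm (m : ℝ) P := by
  have hsum : ∑ i, α i = m := by rw [← Finsupp.degree_eq_sum]; exact hα
  have h := abs_coeff_le_pow_mul_polyNorm (by lia) hP hsum
  have hsqrt : 1 ≤ Real.sqrt 2 ^ (m - 1) :=
    one_le_pow₀ (Real.one_le_sqrt.mpr one_le_two)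
  rw [Real.norm_eq_abs, mul_assoc]
  exact h.trans (le_mul_of_one_le_left ((abs_nonneg _).trans h) hsqrt)
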